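/- (Support theorem.) Let f : ℝ×ℝ → ℂ be continuous, 2π-periodic in its first variable and even, and suppose there exist ε > 0 and positive constants C_n (n ∈ ℤ) such that |F_0(t)| ≤ C_0 and |F_n(t)| ≤ C_n |t|^{|n|−1} for n ≠ 0, whenever |t| < ε. Fix t₀ > 0. If Rf(θ,ρ) = 0 for all θ ∈ ℝ and all ρ ∈ [0, arctan t₀], then f(s, t₀) = 0 for all s ∈ ℝ. -/

import Mathlib

open MeasureTheory Real Filter Set Topology ENNReal NNReal

/-- Parametric Radon transform on the cylinder:
`Rf(θ,ρ) = (1/(2π)) ∫₀^{2π} f(s, −tan ρ · cos(θ−s)) ds`. -/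
noncomputable def RT (f : ℝ → ℝ → ℂ) (θ ρ : ℝ) : ℂ :=
  (1 / (2 * π)) * ∫ s in (0:ℝ)..(2 * π), f s (-Real.tan ρ * Real.cos (θ - s))

/-- `n`-th Fourier coefficient of a function on the cylinder (in the angular variable). -/
noncomputable def Fc (f : ℝ → ℝ → ℂ) (n : ℤ) (t : ℝ) : ℂ :=
  (1 / (2 * π)) * ∫ s in (0:ℝ)..(2 * π), f s t * Complex.exp (-Complex.I * n * s)

/-- `n`-th Fourier coefficient of `Rf` (in the variable θ). -/
noncomputable def Gc (f : ℝ → ℝ → ℂ) (n : ℤ) (ρ : ℝ) : ℂ :=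
  (1 / (2 * π)) * ∫ θ in (0:ℝ)..(2 * π), RT f θ ρ * Complex.exp (-Complex.I * n * θ)

/-- Fubini for continuous functions on a rectangle. -/
lemma intervalIntegral_swap_of_continuous {g : ℝ → ℝ → ℂ}
    (hg : Continuous (Function.uncurry g)) (a b c d : ℝ) :
    ∫ x in a..b, ∫ y in c..d, g x y = ∫ y in c..d, ∫ x in a..b, g x y := by
  apply intervalIntegral_intervalIntegral_swap
  refine (hg.continuousOn.integrableOn_compact
    (isCompact_uIcc.prod isCompact_uIcc)).mono_set
    (Set.prod_mono uIoc_subset_uIcc uIoc_subset_uIcc)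

/-- A continuous function whose primitive vanishes on `[0, t₀]` vanishes there. -/
lemma eq_zero_of_hasDerivAt_of_eq_zero {F H : ℝ → ℂ} {t₀ : ℝ} (ht₀ : 0 < t₀)
    (hF : Continuous F) (hH : ∀ x ∈ Ioo 0 t₀, HasDerivAt H (F x) x)
    (h0 : ∀ x ∈ Ioo 0 t₀, H x = 0) : ∀ x ∈ Icc 0 t₀, F x = 0 := by
  have h1 : Ioo 0 t₀ ⊆ {x | F x = 0} := by
    intro x hx
    have h2 : H =ᶠ[𝓝 x] fun _ => 0 := by
      filter_upwards [isOpen_Ioo.mem_nhds hx] with y hy using h0 y hy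
    exact (hH x hx).unique ((hasDerivAt_const x (0 : ℂ)).congr_of_eventuallyEq h2)
  have h2 := closure_minimal h1 (isClosed_eq hF continuous_const)
  rw [closure_Ioo ht₀.ne] at h2
  exact fun x hx => h2 hx

lemma integral_sqrt_sub_sq (c : ℝ) :
    ∫ b : ℝ, √(c - b ^ 2) = max c 0 * (π / 2) := by
  rcases le_or_gt c 0 with hc | hc
  · rw [max_eq_right hc, zero_mul]
    have : ∀ b : ℝ, √(c - b ^ 2) = 0 := fun b =>
      Real.sqrt_eq_zero_of_nonpos (by nlinarith [sq_nonneg b])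
    simp [this]
  · rw [max_eq_left hc.le]
    have h1 : ∫ b : ℝ, √(1 - b ^ 2) = π / 2 := by
      rw [← integral_sqrt_one_sub_sq, intervalIntegral.integral_of_le (by norm_num)]
      refine (setIntegral_eq_integral_of_forall_compl_eq_zero fun b hb => ?_).symm
      apply Real.sqrt_eq_zero_of_nonpos
      by_contra! h
      have : |b| < 1 := by rw [← sq_lt_one_iff_abs_lt_one]; linarith
      rw [abs_lt] at this
      exact hb ⟨this.1, this.2.le⟩
    have h2 := Measure.integral_comp_mul_left (fun b : ℝ => √(c - b ^ 2)) (√c)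
    have h3 : ∀ b : ℝ, √(c - (√c * b) ^ 2) = √c * √(1 - b ^ 2) := by
      intro b
      rw [← Real.sqrt_mul hc.le, mul_pow, Real.sq_sqrt hc.le]
      ring_nf
    have hs : 0 < √c := Real.sqrt_pos.2 hc
    simp only [h3, integral_const_mul, h1, smul_eq_mul, abs_of_pos (inv_pos.2 hs)] at h2
    have h4 : √c * (√c * (π / 2)) = ∫ b : ℝ, √(c - b ^ 2) := by
      rw [h2, mul_inv_cancel_left₀ hs.ne']
    rw [← h4, ← mul_assoc, Real.mul_self_sqrt hc.le]

/-- If the means of `H (x cos u)` vanish for `x ∈ [0, y]`, so does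
`∫ (y² - a²) H a` over `[-y, y]`. -/
lemma integral_sq_sub_sq_smul_eq_zero {H : ℝ → ℂ} (hH : Continuous H) {y : ℝ} (hy : 0 ≤ y)
    (h : ∀ x ∈ Icc 0 y, ∫ u in -π..π, H (x * Real.cos u) = 0) :
    ∫ a in -y..y, (y ^ 2 - a ^ 2) • H a = 0 := by
  set g : ℝ × ℝ → ℂ := fun p => √(y ^ 2 - p.1 ^ 2 - p.2 ^ 2) • H p.1 with hg
  have hgc : Continuous g := by fun_prop
  have hsupp : HasCompactSupport g := by
    refine HasCompactSupport.intro
      ((isCompact_Icc (a := -y) (b := y)).prod (isCompact_Icc (a := -y) (b := y))) ?_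
    rintro ⟨a, b⟩ hab
    have : √(y ^ 2 - a ^ 2 - b ^ 2) = 0 := by
      apply Real.sqrt_eq_zero_of_nonpos
      by_contra! hc
      exact hab ⟨abs_le.1 (abs_le_of_sq_le_sq (by nlinarith [sq_nonneg b]) hy),
        abs_le.1 (abs_le_of_sq_le_sq (by nlinarith [sq_nonneg a]) hy)⟩
    simp [hg, this]
  have hint : Integrable g := hgc.integrable_of_hasCompactSupport hsupp
  have hpolar : ∫ p, g p = 0 := by
    rw [← integral_comp_polarCoord_symm, polarCoord_target]
    by_cases hI : IntegrableOn (fun p : ℝ × ℝ => p.1 • g (polarCoord.symm p))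
        (Ioi (0 : ℝ) ×ˢ Ioo (-π) π) (volume.prod volume)
    · rw [Measure.volume_eq_prod, setIntegral_prod _ hI]
      refine setIntegral_eq_zero_of_forall_eq_zero fun r hr => ?_
      have hr : 0 < r := hr
      have h1 : ∀ θ : ℝ, r • g (polarCoord.symm (r, θ)) =
          (r * √(y ^ 2 - r ^ 2)) • H (r * Real.cos θ) := by
        intro θ
        have : y ^ 2 - (r * Real.cos θ) ^ 2 - (r * Real.sin θ) ^ 2 = y ^ 2 - r ^ 2 := by
          linear_combination -r ^ 2 * Real.sin_sq_add_cos_sq θ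
        simp only [hg, polarCoord_symm_apply, this, smul_smul]
      simp only [h1, integral_smul]
      rcases le_or_gt r y with hry | hry
      · rw [← integral_Ioc_eq_integral_Ioo,
          ← intervalIntegral.integral_of_le (by linarith [Real.pi_pos]), h r ⟨hr.le, hry⟩, smul_zero]
      · rw [Real.sqrt_eq_zero_of_nonpos (by nlinarith), mul_zero, zero_smul]
    · exact integral_undef hI
  rw [Measure.volume_eq_prod, integral_prod _ hint] at hpolar
  simp only [hg, integral_smul_const, integral_sqrt_sub_sq] at hpolar
  have h2 : ∫ a : ℝ, max (y ^ 2 - a ^ 2) 0 • H a = 0 := by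
    have h3 : ∀ a : ℝ, (max (y ^ 2 - a ^ 2) 0 * (π / 2)) • H a =
        (π / 2) • (max (y ^ 2 - a ^ 2) 0 • H a) := fun a => by
      rw [smul_smul, mul_comm]
    simp only [h3, integral_smul] at hpolar
    exact (smul_eq_zero.1 hpolar).resolve_left (by positivity)
  rw [intervalIntegral.integral_of_le (by linarith), ← h2,
    ← setIntegral_eq_integral_of_forall_compl_eq_zero (s := Ioc (-y) y)
      (f := fun a : ℝ => max (y ^ 2 - a ^ 2) 0 • H a)]
  · refine setIntegral_congr_fun measurableSet_Ioc fun a ha => ?_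
    have : 0 ≤ y ^ 2 - a ^ 2 := by nlinarith [ha.1, ha.2]
    simp only [max_eq_left this]
  · intro a ha
    have : y ^ 2 - a ^ 2 ≤ 0 := by
      by_contra! hc
      have := abs_lt.1 (abs_lt_of_sq_lt_sq (by linarith : a ^ 2 < y ^ 2) hy)
      exact ha ⟨this.1, this.2.le⟩
    rw [max_eq_right this, zero_smul]

/-- Uniqueness for Abel's integral equation. -/
lemma eq_zero_of_integral_comp_mul_cos_eq_zero {H : ℝ → ℂ} (hH : Continuous H)
    (heven : ∀ t, H (-t) = H t) {t₀ : ℝ} (ht₀ : 0 < t₀)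
    (h : ∀ x ∈ Icc 0 t₀, ∫ u in -π..π, H (x * Real.cos u) = 0) :
    ∀ t ∈ Icc 0 t₀, H t = 0 := by
  set P : ℝ → ℂ := fun y => ∫ a in (0 : ℝ)..y, H a with hP
  set Q : ℝ → ℂ := fun y => ∫ a in (0 : ℝ)..y, (a ^ 2 : ℝ) • H a with hQ
  have hc2 : Continuous fun a : ℝ => (a ^ 2 : ℝ) • H a := by fun_prop
  have hP' : ∀ y, HasDerivAt P (H y) y := fun y => hH.integral_hasStrictDerivAt 0 y |>.hasDerivAt
  have hQ' : ∀ y, HasDerivAt Q ((y ^ 2 : ℝ) • H y) y :=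
    fun y => hc2.integral_hasStrictDerivAt 0 y |>.hasDerivAt
  have hPc : Continuous P := continuous_iff_continuousAt.2 fun y => (hP' y).continuousAt
  have h1 : ∀ y ∈ Icc 0 t₀, (y ^ 2 : ℝ) • P y - Q y = 0 := by
    intro y hy
    have h2 := integral_sq_sub_sq_smul_eq_zero hH hy.1
      fun x hx => h x ⟨hx.1, hx.2.trans hy.2⟩
    have hc : Continuous fun a : ℝ => (y ^ 2 - a ^ 2) • H a := by fun_prop
    have h3 : ∫ a in -y..0, (y ^ 2 - a ^ 2) • H a = ∫ a in 0..y, (y ^ 2 - a ^ 2) • H a := by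
      have := intervalIntegral.integral_comp_neg (a := 0) (b := y)
        (fun a : ℝ => (y ^ 2 - a ^ 2) • H a)
      simpa [heven] using this.symm
    rw [← intervalIntegral.integral_add_adjacent_intervals (b := 0)
      (hc.intervalIntegrable _ _) (hc.intervalIntegrable _ _), h3, ← two_mul] at h2
    have h4 := (mul_eq_zero.1 h2).resolve_left two_ne_zero
    have hc1 : Continuous fun a : ℝ => (y ^ 2 : ℝ) • H a := by fun_prop
    simp only [sub_smul] at h4
    rw [intervalIntegral.integral_sub (hc1.intervalIntegrable _ _) (hc2.intervalIntegrable _ _),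
      intervalIntegral.integral_smul] at h4
    exact h4
  have h2 : ∀ y ∈ Icc 0 t₀, (2 * y) • P y = 0 := by
    refine eq_zero_of_hasDerivAt_of_eq_zero (H := fun y => (y ^ 2 : ℝ) • P y - Q y) ht₀
      (by fun_prop) (fun y _ => ?_) fun y hy => h1 y (Ioo_subset_Icc_self hy)
    refine (((hasDerivAt_pow 2 y).smul (hP' y)).sub (hQ' y)).congr_deriv ?_
    norm_num
  exact eq_zero_of_hasDerivAt_of_eq_zero ht₀ hH (fun y _ => hP' y) fun y hy =>
    (smul_eq_zero.1 (h2 y (Ioo_subset_Icc_self hy))).resolve_left (by linarith [hy.1])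

/-- The transform `F ↦ ∫ F (x cos u) cos (n u) du`, which the Radon transform induces on the
`n`-th Fourier coefficient. -/
noncomputable def cosTransform (n : ℕ) (F : ℝ → ℂ) (x : ℝ) : ℂ :=
  ∫ u in -π..π, F (x * Real.cos u) * Real.cos (n * u)

lemma hasDerivAt_cosTransform (n : ℕ) {F H : ℝ → ℂ} (hF : Continuous F)
    (hH : ∀ t, HasDerivAt H (F t) t) (x : ℝ) :
    HasDerivAt (cosTransform n H)
      (∫ u in -π..π, F (x * Real.cos u) * Real.cos u * Real.cos (n * u)) x := by
  have hHc : Continuous H := continuous_iff_continuousAt.2 fun y => (hH y).continuousAt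
  have hFc : Continuous fun y => ∫ u in -π..π, F (y * Real.cos u) * Real.cos u * Real.cos (n * u) :=
    intervalIntegral.continuous_parametric_intervalIntegral_of_continuous' (by fun_prop) _ _
  have h1 : ∀ y, cosTransform n H y = cosTransform n H 0 +
      ∫ z in (0 : ℝ)..y, ∫ u in -π..π, F (z * Real.cos u) * Real.cos u * Real.cos (n * u) := by
    intro y
    have hc : ∀ z : ℝ, Continuous fun u => H (z * Real.cos u) * Real.cos (n * u) := fun z => by
      fun_prop
    rw [intervalIntegral_swap_of_continuous (by fun_prop), ← sub_eq_iff_eq_add', cosTransform,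
      cosTransform, ← intervalIntegral.integral_sub ((hc y).intervalIntegrable _ _)
        ((hc 0).intervalIntegrable _ _)]
    refine intervalIntegral.integral_congr fun u _ => ?_
    have h2 : ∀ z ∈ uIcc 0 y, HasDerivAt (fun z => H (z * Real.cos u) * Real.cos (n * u))
        (F (z * Real.cos u) * Real.cos u * Real.cos (n * u)) z := by
      intro z _
      have h3 : HasDerivAt (fun z : ℝ => z * Real.cos u) (Real.cos u) z := by
        simpa using (hasDerivAt_id z).mul_const (Real.cos u)
      have h4 := ((hH (z * Real.cos u)).scomp z h3).mul_const (Real.cos (n * u) : ℂ)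
      rw [Complex.real_smul, mul_comm (Real.cos u : ℂ)] at h4
      exact h4
    rw [intervalIntegral.integral_eq_sub_of_hasDerivAt h2
      (Continuous.intervalIntegrable (by fun_prop) _ _)]
  rw [show cosTransform n H = fun y => _ from funext h1]
  exact (hFc.integral_hasStrictDerivAt 0 x).hasDerivAt.const_add _

/-- Integration by parts relating the transform of a function to that of its primitive. -/
lemma mul_deriv_cosTransform_sub (n : ℕ) {F H : ℝ → ℂ} (hF : Continuous F)
    (hH : ∀ t, HasDerivAt H (F t) t) (x : ℝ) :
    x * (∫ u in -π..π, F (x * Real.cos u) * Real.cos u * Real.cos (n * u)) -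
      n * cosTransform n H x = x * cosTransform (n + 1) F x := by
  have hHc : Continuous H := continuous_iff_continuousAt.2 fun y => (hH y).continuousAt
  have h1 : ∀ u ∈ uIcc (-π) π, HasDerivAt (fun u => H (x * Real.cos u) * Real.sin (n * u))
      (n * (H (x * Real.cos u) * Real.cos (n * u)) -
        x * (F (x * Real.cos u) * (Real.sin u * Real.sin (n * u)))) u := by
    intro u _
    have h3 : HasDerivAt (fun u : ℝ => x * Real.cos u) (x * -Real.sin u) u :=
      (Real.hasDerivAt_cos u).const_mul x
    have h4 := (hH (x * Real.cos u)).scomp u h3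
    have h5 : HasDerivAt (fun u : ℝ => Real.sin (n * u)) (Real.cos (n * u) * n) u := by
      have h6 := (Real.hasDerivAt_sin (n * u)).comp u ((hasDerivAt_id u).const_mul (n : ℝ))
      rw [mul_one] at h6
      exact h6
    refine (h4.mul h5.ofReal_comp).congr_deriv ?_
    simp only [Complex.real_smul, Function.comp]
    push_cast
    ring
  have h2 := intervalIntegral.integral_eq_sub_of_hasDerivAt h1
    (Continuous.intervalIntegrable (by fun_prop) _ _)
  have h3 : Real.sin (n * π) = 0 := Real.sin_nat_mul_pi n
  rw [intervalIntegral.integral_sub (Continuous.intervalIntegrable (by fun_prop) _ _)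
    (Continuous.intervalIntegrable (by fun_prop) _ _), intervalIntegral.integral_const_mul,
    intervalIntegral.integral_const_mul, mul_neg, Real.sin_neg, h3] at h2
  have h4 : cosTransform (n + 1) F x =
      (∫ u in -π..π, F (x * Real.cos u) * Real.cos u * Real.cos (n * u)) -
        ∫ u in -π..π, F (x * Real.cos u) * (Real.sin u * Real.sin (n * u)) := by
    rw [← intervalIntegral.integral_sub (Continuous.intervalIntegrable (by fun_prop) _ _)
      (Continuous.intervalIntegrable (by fun_prop) _ _), cosTransform]
    refine intervalIntegral.integral_congr fun u _ => ?_
    have : ((n + 1 : ℕ) : ℝ) * u = n * u + u := by push_cast; ring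
    simp only [this, Real.cos_add]
    push_cast
    ring
  have h5 : cosTransform n H x = ∫ u in -π..π, H (x * Real.cos u) * Real.cos (n * u) := rfl
  rw [h4, h5]
  simp only [Complex.ofReal_zero, neg_zero, mul_zero, sub_zero] at h2
  linear_combination -h2

/-- If the `(n + 1)`-st transform of a function vanishes and its primitive is `O(t ^ (n + 1))`
at the origin, then the `n`-th transform of the primitive vanishes. -/
lemma cosTransform_primitive_eq_zero (n : ℕ) {F H : ℝ → ℂ} (hF : Continuous F)
    (hH : ∀ t, HasDerivAt H (F t) t) {t₀ ε C : ℝ} (ht₀ : 0 < t₀) (hε : 0 < ε)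
    (hb : ∀ t, |t| < ε → ‖H t‖ ≤ C * |t| ^ (n + 1))
    (h : ∀ x ∈ Icc 0 t₀, cosTransform (n + 1) F x = 0) :
    ∀ x ∈ Icc 0 t₀, cosTransform n H x = 0 := by
  have hd := hasDerivAt_cosTransform n hF hH
  have hC : 0 ≤ C := by
    have h1 := (norm_nonneg _).trans (hb (ε / 2) (by rw [abs_of_pos] <;> linarith))
    have h2 : 0 < |ε / 2| ^ (n + 1) := by positivity
    exact nonneg_of_mul_nonneg_left h1 h2
  obtain ⟨c, hc⟩ : ∃ c, ∀ x ∈ Ioo 0 t₀, cosTransform n H x / (x : ℂ) ^ n = c := by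
    have hq : ∀ x ∈ Ioo 0 t₀, HasDerivAt (fun x : ℝ => cosTransform n H x / (x : ℂ) ^ n) 0 x := by
      intro x hx
      have hx0 : (x : ℂ) ≠ 0 := by exact_mod_cast hx.1.ne'
      have hp : HasDerivAt (fun x : ℝ => (x : ℂ) ^ n) (n * (x : ℂ) ^ (n - 1)) x := by
        simpa using (hasDerivAt_pow n x).ofReal_comp
      refine ((hd x).div hp (pow_ne_zero n hx0)).congr_deriv ?_
      have h1 := mul_deriv_cosTransform_sub n hF hH x
      rw [h x (Ioo_subset_Icc_self hx), mul_zero] at h1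
      have h2 : n * (x : ℂ) ^ (n - 1) * x = n * (x : ℂ) ^ n := by
        rcases n with _ | n
        · simp
        · simp [pow_succ, mul_assoc]
      have h3 : (∫ u in -π..π, F (x * Real.cos u) * Real.cos u * Real.cos (n * u)) * (x : ℂ) ^ n -
          cosTransform n H x * (n * (x : ℂ) ^ (n - 1)) = 0 := by
        refine (mul_eq_zero.1 (?_ : (x : ℂ) * _ = 0)).resolve_left hx0
        linear_combination (x : ℂ) ^ n * h1 - cosTransform n H x * h2
      exact div_eq_zero_iff.2 (Or.inl h3)
    exact isOpen_Ioo.exists_is_const_of_deriv_eq_zero isPreconnected_Ioo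
      (fun x hx => (hq x hx).differentiableAt.differentiableWithinAt) fun x hx => (hq x hx).deriv
  have hc' : ∀ x ∈ Ioo 0 t₀, cosTransform n H x = c * (x : ℂ) ^ n := by
    intro x hx
    have hx0 : (x : ℂ) ≠ 0 := by exact_mod_cast hx.1.ne'
    rw [← hc x hx, div_mul_cancel₀ _ (pow_ne_zero n hx0)]
  have hle : ∀ᶠ x in 𝓝[>] (0 : ℝ), ‖c‖ ≤ C * (2 * π) * x := by
    filter_upwards [Ioo_mem_nhdsGT ht₀, Ioo_mem_nhdsGT hε] with x hx hxε
    have h1 : ‖cosTransform n H x‖ ≤ C * x ^ (n + 1) * |π - -π| := by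
      refine intervalIntegral.norm_integral_le_of_norm_le_const fun u _ => ?_
      have h2 : |x * Real.cos u| ≤ x := by
        rw [abs_mul, abs_of_pos hx.1]
        exact mul_le_of_le_one_right hx.1.le (Real.abs_cos_le_one u)
      rw [norm_mul, Complex.norm_real, Real.norm_eq_abs]
      calc _ ≤ ‖H (x * Real.cos u)‖ :=
            mul_le_of_le_one_right (norm_nonneg _) (Real.abs_cos_le_one _)
        _ ≤ C * |x * Real.cos u| ^ (n + 1) := hb _ (h2.trans_lt hxε.2)
        _ ≤ C * x ^ (n + 1) := by gcongr
    rw [hc' x hx, norm_mul, norm_pow, Complex.norm_real, Real.norm_eq_abs, abs_of_pos hx.1,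
      abs_of_pos (by linarith [Real.pi_pos])] at h1
    have h3 : 0 < x ^ n := pow_pos hx.1 n
    refine le_of_mul_le_mul_right (h1.trans_eq ?_) h3
    ring
  have h0 : ‖c‖ ≤ 0 := by
    have ht : Tendsto (fun x : ℝ => C * (2 * π) * x) (𝓝[>] 0) (𝓝 (C * (2 * π) * 0)) :=
      (Continuous.tendsto (by fun_prop) 0).mono_left nhdsWithin_le_nhds
    rw [mul_zero] at ht
    exact ge_of_tendsto ht hle
  have hz : c = 0 := norm_le_zero_iff.1 h0
  have hcont : Continuous (cosTransform n H) :=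
    continuous_iff_continuousAt.2 fun x => (hd x).continuousAt
  have hsub : Ioo 0 t₀ ⊆ {x | cosTransform n H x = 0} := fun x hx => by
    simp [hc' x hx, hz]
  have := closure_minimal hsub (isClosed_eq hcont continuous_const)
  rw [closure_Ioo ht₀.ne] at this
  exact fun x hx => this hx

/-- Injectivity of the `n`-th transform on functions that are `O(t ^ (n - 1))` at the origin. -/
lemma eq_zero_of_cosTransform_eq_zero {t₀ : ℝ} (ht₀ : 0 < t₀) (n : ℕ) :
    ∀ {F : ℝ → ℂ}, Continuous F → (∀ t, F (-t) = (-1) ^ n * F t) →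
      ∀ {ε C : ℝ}, 0 < ε → (∀ t, |t| < ε → ‖F t‖ ≤ C * |t| ^ (n - 1)) →
      (∀ x ∈ Icc 0 t₀, cosTransform n F x = 0) → ∀ t ∈ Icc 0 t₀, F t = 0 := by
  induction n with
  | zero =>
    intro F hF hpar ε C _ _ h
    exact eq_zero_of_integral_comp_mul_cos_eq_zero hF (by simpa using hpar) ht₀
      (by simpa [cosTransform] using h)
  | succ n ih =>
    intro F hF hpar ε C hε hb h
    simp only [Nat.add_sub_cancel] at hb
    set H : ℝ → ℂ := fun y => ∫ a in (0 : ℝ)..y, F a with hHdef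
    have hH : ∀ y, HasDerivAt H (F y) y :=
      fun y => hF.integral_hasStrictDerivAt 0 y |>.hasDerivAt
    have hHc : Continuous H := continuous_iff_continuousAt.2 fun y => (hH y).continuousAt
    have hC : 0 ≤ C := by
      have h1 := (norm_nonneg _).trans (hb (ε / 2) (by rw [abs_of_pos] <;> linarith))
      have h2 : 0 < |ε / 2| ^ n := by positivity
      exact nonneg_of_mul_nonneg_left h1 h2
    have hHb : ∀ t, |t| < ε → ‖H t‖ ≤ C * |t| ^ (n + 1) := by
      intro t ht
      have h1 : ‖H t‖ ≤ C * |t| ^ n * |t - 0| := by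
        refine intervalIntegral.norm_integral_le_of_norm_le_const fun a ha => ?_
        have h2 : |a| ≤ |t| := by
          simpa using abs_sub_left_of_mem_uIcc (uIoc_subset_uIcc ha)
        refine (hb a (h2.trans_lt ht)).trans ?_
        gcongr
      rw [sub_zero] at h1
      exact h1.trans_eq (by ring)
    have hHpar : ∀ t, H (-t) = (-1) ^ n * H t := by
      intro t
      have h1 := intervalIntegral.integral_comp_neg (a := 0) (b := t) F
      simp only [hpar, intervalIntegral.integral_const_mul, neg_zero] at h1
      simp only [hHdef]
      rw [intervalIntegral.integral_symm, ← h1]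
      ring
    have hHb' : ∀ t, |t| < ε → ‖H t‖ ≤ C * ε ^ (n + 1 - (n - 1)) * |t| ^ (n - 1) := by
      intro t ht
      refine (hHb t ht).trans ?_
      rw [mul_assoc, ← pow_sub_mul_pow |t| (show n - 1 ≤ n + 1 by omega)]
      gcongr
    have hHz := ih hHc hHpar hε hHb' (cosTransform_primitive_eq_zero n hF hH ht₀ hε hHb h)
    exact eq_zero_of_hasDerivAt_of_eq_zero ht₀ hF (fun y _ => hH y)
      fun y hy => hHz y (Ioo_subset_Icc_self hy)

lemma continuous_Fc {f : ℝ → ℝ → ℂ} (hf : Continuous (Function.uncurry f)) (n : ℤ) :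
    Continuous (Fc f n) := by
  refine continuous_const.mul
    (intervalIntegral.continuous_parametric_intervalIntegral_of_continuous' ?_ _ _)
  have : Continuous fun p : ℝ × ℝ => f p.2 p.1 := hf.comp continuous_swap
  fun_prop

lemma exp_neg_I_mul_add_two_pi (n : ℤ) (s : ℝ) :
    Complex.exp (-Complex.I * n * (s + 2 * π : ℝ)) = Complex.exp (-Complex.I * n * s) := by
  rw [Complex.exp_eq_exp_iff_exists_int]
  exact ⟨-n, by push_cast; ring⟩

lemma exp_neg_I_mul_add_pi (n : ℤ) (s : ℝ) :
    Complex.exp (-Complex.I * n * (s + π : ℝ)) =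
      (-1) ^ n.natAbs * Complex.exp (-Complex.I * n * s) := by
  have h : Complex.exp (-Complex.I * n * π) = (-1) ^ n.natAbs := by
    have h2 := Int.natAbs_eq n
    have h1 : -Complex.I * n * π = (-n : ℤ) * (π * Complex.I) := by push_cast; ring
    rw [h1, Complex.exp_int_mul, Complex.exp_pi_mul_I]
    generalize n.natAbs = m at *
    rcases h2 with rfl | rfl <;> simp [← inv_pow]
  rw [← h, ← Complex.exp_add]
  congr 1
  push_cast
  ring

/-- Fourier coefficients of an even function on the cylinder have the parity of their index. -/
lemma Fc_neg {f : ℝ → ℝ → ℂ} (hper : ∀ s t : ℝ, f (s + 2 * π) t = f s t)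
    (heven : ∀ s t : ℝ, f (s + π) (-t) = f s t) (n : ℤ) (t : ℝ) :
    Fc f n (-t) = (-1) ^ n.natAbs * Fc f n t := by
  have hp : Function.Periodic (fun s : ℝ => f s (-t) * Complex.exp (-Complex.I * n * s))
      (2 * π) := fun s => by
    simp only [hper, exp_neg_I_mul_add_two_pi]
  have h1 := hp.intervalIntegral_add_eq 0 π
  have h2 := intervalIntegral.integral_comp_add_right (a := 0) (b := 2 * π)
    (fun s : ℝ => f s (-t) * Complex.exp (-Complex.I * n * s)) π
  rw [zero_add] at h1
  rw [zero_add, add_comm (2 * π) π, ← h1] at h2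
  simp only [heven, exp_neg_I_mul_add_pi] at h2
  have h3 : ∀ s : ℝ, f s t * ((-1) ^ n.natAbs * Complex.exp (-Complex.I * n * s)) =
      (-1) ^ n.natAbs * (f s t * Complex.exp (-Complex.I * n * s)) := fun s => by ring
  simp only [h3, intervalIntegral.integral_const_mul] at h2
  rw [Fc, Fc, ← h2]
  ring

/-- The Radon transform acts on Fourier coefficients through `cosTransform`. -/
lemma cosTransform_Fc_eq_zero {f : ℝ → ℝ → ℂ} (hf : Continuous (Function.uncurry f))
    (hper : ∀ s t : ℝ, f (s + 2 * π) t = f s t)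
    (heven : ∀ s t : ℝ, f (s + π) (-t) = f s t) (n : ℤ) (x : ℝ)
    (h : ∀ θ, ∫ s in (0 : ℝ)..(2 * π), f s (-x * Real.cos (θ - s)) = 0) :
    cosTransform n.natAbs (Fc f n) x = 0 := by
  have hf' : ∀ {g₁ g₂ : ℝ × ℝ → ℝ}, Continuous g₁ → Continuous g₂ →
      Continuous fun p => f (g₁ p) (g₂ p) := fun h₁ h₂ => hf.comp (h₁.prodMk h₂)
  set E : ℝ → ℂ := fun s => Complex.exp (-Complex.I * n * s) with hEdef
  have hEadd : ∀ a b : ℝ, E (a + b) = E a * E b := fun a b => by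
    simp only [hEdef, ← Complex.exp_add]
    congr 1
    push_cast
    ring
  have hFcont := continuous_Fc hf n
  have hEc : Continuous E := by fun_prop
  have h1 : ∫ θ in (0 : ℝ)..(2 * π), ∫ s in (0 : ℝ)..(2 * π),
      f s (-x * Real.cos (θ - s)) * E θ = 0 := by
    simp only [intervalIntegral.integral_mul_const, h, zero_mul, intervalIntegral.integral_zero]
  rw [intervalIntegral_swap_of_continuous (by
    have := hf' continuous_snd (g₂ := fun p => -x * Real.cos (p.1 - p.2)) (by fun_prop)
    fun_prop)] at h1
  have h2 : ∀ s, ∫ θ in (0 : ℝ)..(2 * π), f s (-x * Real.cos (θ - s)) * E θ =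
      ∫ u in -π..π, f s (-x * Real.cos u) * E s * E u := by
    intro s
    have hp : Function.Periodic (fun u : ℝ => f s (-x * Real.cos u) * E s * E u) (2 * π) :=
      fun u => by
        have := exp_neg_I_mul_add_two_pi n u
        simp only [hEdef, Real.cos_add_two_pi, this]
    have h3 := intervalIntegral.integral_comp_sub_right (a := 0) (b := 2 * π)
      (fun u : ℝ => f s (-x * Real.cos u) * E s * E u) s
    rw [zero_sub, sub_eq_neg_add, hp.intervalIntegral_add_eq (-s) (-π)] at h3
    have h4 : -π + 2 * π = π := by ring
    rw [h4] at h3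
    rw [← h3]
    congr 1 with θ
    rw [mul_assoc, ← hEadd, add_sub_cancel]
  simp only [h2] at h1
  rw [intervalIntegral_swap_of_continuous (by
    have := hf' continuous_fst (g₂ := fun p => -x * Real.cos p.2) (by fun_prop)
    fun_prop)] at h1
  have h5 : ∀ u : ℝ, ∫ s in (0 : ℝ)..(2 * π), f s (-x * Real.cos u) * E s * E u =
      2 * π * (-1) ^ n.natAbs * (Fc f n (x * Real.cos u) * E u) := by
    intro u
    have h6 : -x * Real.cos u = -(x * Real.cos u) := by ring
    have h7 := Fc_neg hper heven n (x * Real.cos u)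
    rw [intervalIntegral.integral_mul_const, h6]
    have hpi : (π : ℂ) ≠ 0 := by exact_mod_cast Real.pi_ne_zero
    have h8 : ∫ s in (0 : ℝ)..(2 * π), f s (-(x * Real.cos u)) * E s =
        2 * π * Fc f n (-(x * Real.cos u)) := by
      rw [Fc, ← mul_assoc, mul_one_div_cancel (by simp [hpi]), one_mul]
    rw [h8, h7]
    ring
  simp only [h5, intervalIntegral.integral_const_mul] at h1
  have h9 : ∫ u in -π..π, Fc f n (x * Real.cos u) * E u = 0 := by
    refine (mul_eq_zero.1 h1).resolve_left ?_
    have hpi : (π : ℂ) ≠ 0 := by exact_mod_cast Real.pi_ne_zero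
    simp [hpi]
  have h10 : ∫ u in -π..π, Fc f n (x * Real.cos u) * E (-u) = 0 := by
    have := intervalIntegral.integral_comp_neg (a := -π) (b := π)
      (fun u : ℝ => Fc f n (x * Real.cos u) * E u)
    simp only [Real.cos_neg, neg_neg] at this
    rw [this, h9]
  have h11 : ∀ u : ℝ, Fc f n (x * Real.cos u) * Real.cos (n.natAbs * u) =
      (1 / 2) * (Fc f n (x * Real.cos u) * E u + Fc f n (x * Real.cos u) * E (-u)) := by
    intro u
    have h12 : Real.cos (n.natAbs * u) = Real.cos (n * u) := by
      rw [Nat.cast_natAbs, Int.cast_abs]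
      rcases abs_choice (n : ℝ) with h | h <;> rw [h]
      rw [neg_mul, Real.cos_neg]
    rw [h12, Complex.ofReal_cos, Complex.cos]
    have h13 : Complex.exp (((n * u : ℝ) : ℂ) * Complex.I) = E (-u) := by
      simp only [hEdef]; congr 1; push_cast; ring
    have h14 : Complex.exp (-((n * u : ℝ) : ℂ) * Complex.I) = E u := by
      simp only [hEdef]; congr 1; push_cast; ring
    rw [h13, h14]
    ring
  rw [cosTransform]
  simp only [h11]
  rw [intervalIntegral.integral_const_mul, intervalIntegral.integral_add
    (Continuous.intervalIntegrable (by fun_prop) _ _)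
    (Continuous.intervalIntegrable (by fun_prop) _ _), h9, h10, add_zero, mul_zero]

/-- A continuous periodic function whose Fourier coefficients all vanish is zero. -/
lemma eq_zero_of_Fc_eq_zero {f : ℝ → ℝ → ℂ} (hf : Continuous (Function.uncurry f))
    (hper : ∀ s t : ℝ, f (s + 2 * π) t = f s t) (t : ℝ) (h : ∀ n, Fc f n t = 0) (s : ℝ) :
    f s t = 0 := by
  have : Fact (0 < 2 * π) := ⟨Real.two_pi_pos⟩
  have hp : Function.Periodic (fun s => f s t) (2 * π) := fun s => hper s t
  have hc : Continuous fun s => f s t := hf.comp (continuous_id.prodMk continuous_const)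
  let g : C(AddCircle (2 * π), ℂ) := ⟨hp.lift, continuous_coinduced_dom.mpr hc⟩
  have hg : ∀ s : ℝ, g (s : AddCircle (2 * π)) = f s t := fun s => rfl
  have hcoef : fourierCoeff g = 0 := by
    ext n
    rw [fourierCoeff_eq_intervalIntegral _ _ 0, Pi.zero_apply, ← h n, Fc, zero_add]
    simp only [hg, fourier_coe_apply, Complex.real_smul, smul_eq_mul]
    push_cast
    congr 2 with s
    rw [mul_comm]
    congr 2
    have hpi : (π : ℂ) ≠ 0 := by exact_mod_cast Real.pi_ne_zero
    field_simp
  have hs := hasSum_fourier_series_of_summable (f := g) (by rw [hcoef]; exact summable_zero)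
  simp only [hcoef, Pi.zero_apply, zero_smul] at hs
  have : g = 0 := hs.unique hasSum_zero
  rw [← hg, this, ContinuousMap.zero_apply]

/-- support theorem for the parametric Radon transform. -/
theorem statement5 (f : ℝ → ℝ → ℂ)
    (hcont : Continuous (Function.uncurry f))
    (hper : ∀ s t : ℝ, f (s + 2 * π) t = f s t)
    (heven : ∀ s t : ℝ, f (s + π) (-t) = f s t)
    (ε : ℝ) (hε : 0 < ε) (C : ℤ → ℝ) (hC : ∀ n : ℤ, 0 < C n)
    (hF0 : ∀ t : ℝ, |t| < ε → ‖Fc f 0 t‖ ≤ C 0)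
    (hFn : ∀ n : ℤ, n ≠ 0 → ∀ t : ℝ, |t| < ε → ‖Fc f n t‖ ≤ C n * |t| ^ (n.natAbs - 1))
    (t₀ : ℝ) (ht₀ : 0 < t₀)
    (hzero : ∀ θ : ℝ, ∀ ρ ∈ Set.Icc (0:ℝ) (Real.arctan t₀), RT f θ ρ = 0) :
    ∀ s : ℝ, f s t₀ = 0 := by
  refine eq_zero_of_Fc_eq_zero hcont hper t₀ fun n => ?_
  refine eq_zero_of_cosTransform_eq_zero ht₀ n.natAbs (continuous_Fc hcont n)
    (Fc_neg hper heven n) hε (C := C n) ?_ (fun x hx => ?_) t₀ ⟨ht₀.le, le_rfl⟩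
  · rcases eq_or_ne n 0 with rfl | hn
    · simpa using hF0
    · exact hFn n hn
  · refine cosTransform_Fc_eq_zero hcont hper heven n x fun θ => ?_
    have h1 := hzero θ (Real.arctan x)
      ⟨Real.arctan_nonneg.2 hx.1, Real.arctan_strictMono.monotone hx.2⟩
    rw [RT, Real.tan_arctan] at h1
    have hpi : (π : ℂ) ≠ 0 := by exact_mod_cast Real.pi_ne_zero
    exact (mul_eq_zero.1 h1).resolve_left (by simp [hpi])
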